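/- Fix q ∈ ℝ with q ≠ 0 and q² ≠ 1, and let L̂, M̂₁, M̂₂, R̂₁, R̂₂ be the S-Heun operators on the q-linear grid. Then the operator M̂₂R̂₁ − M̂₁R̂₂ equals the operator of multiplication by the variable: for every function f : ℝ → ℝ and every z ≠ 0, ((M̂₂R̂₁ − M̂₁R̂₂)f)(z) = z·f(z). -/

import Mathlib

/-- Lowering S-Heun operator `L̂ = (q−q⁻¹)⁻¹ z⁻¹(T̂₊−T̂₋)` on the q-linear grid. -/
noncomputable def hL (q : ℝ) (f : ℝ → ℝ) : ℝ → ℝ :=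
  fun z => (q - q⁻¹)⁻¹ * z⁻¹ * (f (q*z) - f (q⁻¹*z))
/-- Stabilizing S-Heun operator `M̂₁ = (q−q⁻¹)⁻¹(−q⁻¹T̂₊+qT̂₋)`. -/
noncomputable def hM1 (q : ℝ) (f : ℝ → ℝ) : ℝ → ℝ :=
  fun z => (q - q⁻¹)⁻¹ * (-q⁻¹ * f (q*z) + q * f (q⁻¹*z))
/-- Stabilizing S-Heun operator `M̂₂ = (q−q⁻¹)⁻¹(T̂₊−T̂₋)`. -/
noncomputable def hM2 (q : ℝ) (f : ℝ → ℝ) : ℝ → ℝ :=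
  fun z => (q - q⁻¹)⁻¹ * (f (q*z) - f (q⁻¹*z))
/-- Raising S-Heun operator `R̂₁ = (q−q⁻¹)⁻¹ z(−q⁻¹T̂₊+qT̂₋)`. -/
noncomputable def hR1 (q : ℝ) (f : ℝ → ℝ) : ℝ → ℝ :=
  fun z => (q - q⁻¹)⁻¹ * z * (-q⁻¹ * f (q*z) + q * f (q⁻¹*z))
/-- Raising S-Heun operator `R̂₂ = (q−q⁻¹)⁻¹ z(T̂₊−T̂₋)`. -/
noncomputable def hR2 (q : ℝ) (f : ℝ → ℝ) : ℝ → ℝ :=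
  fun z => (q - q⁻¹)⁻¹ * z * (f (q*z) - f (q⁻¹*z))

/-- `M̂₂R̂₁ − M̂₁R̂₂` equals multiplication by the variable. -/
theorem stmt_13 (q : ℝ) (hq : q ≠ 0) (hq2 : q^2 ≠ 1) :
    ∀ (f : ℝ → ℝ) (z : ℝ), z ≠ 0 →
      hM2 q (hR1 q f) z - hM1 q (hR2 q f) z = z * f z := by
  intro f z _
  have h1 : q * (q⁻¹ * z) = z := by field_simp
  have h2 : q⁻¹ * (q * z) = z := by field_simp
  have h3 : q - q⁻¹ ≠ 0 := by
    intro h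
    apply hq2
    field_simp at h
    linarith
  have h4 : q * q⁻¹ = 1 := mul_inv_cancel₀ hq
  have h5 : (q - q⁻¹)⁻¹ * (q - q⁻¹) = 1 := inv_mul_cancel₀ h3
  simp only [hM1, hM2, hR1, hR2, h1, h2]
  generalize f (q * (q * z)) = A
  generalize f (q⁻¹ * (q⁻¹ * z)) = B
  generalize f z = C
  generalize (q - q⁻¹)⁻¹ = c at *
  generalize q⁻¹ = p at *
  have h6 : c ^ 2 * (q - p) ^ 2 = 1 := by rw [← mul_pow, h5, one_pow]
  linear_combination z * C * h6
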